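/- Let 𝕀 denote the one-element ternary structure whose relation consists of its constant triple, and let ν be any index set. Consider the power (𝕊 ⊔ 𝕀)^ν of the disjoint union 𝕊 ⊔ 𝕀. For an element z of (𝕊 ⊔ 𝕀)^ν, let T_z = {i ∈ ν : z(i) lies in the 𝕊-part}. Then: (a) two elements z, w of (𝕊 ⊔ 𝕀)^ν lie in the same connected component if and only if T_z = T_w; (b) the connected component of z is isomorphic to 𝕊^{T_z}; consequently, every connected component of (𝕊 ⊔ 𝕀)^ν is isomorphic to 𝕊^T for some subset T ⊆ ν, and for every subset T ⊆ ν some connected component of (𝕊 ⊔ 𝕀)^ν is isomorphic to 𝕊^T. -/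

import Mathlib

universe u

/-- The ternary relation of the two-element semilattice structure `𝕊` on `{0,1}`
(encoded as `Bool`): the set of triples `{(0,0,0), (0,1,0), (1,0,0), (1,1,1)}`. -/
def SRel : Bool → Bool → Bool → Prop := fun a b c => c = (a && b)

/-- The ternary relation of the disjoint union `𝕊 ⊔ 𝕀` on `Option Bool`:
`some`-elements form a copy of `𝕊` and `none` is the element of the one-element
structure `𝕀` whose relation consists of its constant triple. -/
def SIRel : Option Bool → Option Bool → Option Bool → Prop :=
  fun a b c =>
    (∃ p q r, SRel p q r ∧ a = some p ∧ b = some q ∧ c = some r) ∨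
    (a = none ∧ b = none ∧ c = none)

/-- The `I`-th power of a ternary structure, with the relation taken coordinatewise. -/
def PowRel (I : Type u) {G : Type*} (R : G → G → G → Prop) :
    (I → G) → (I → G) → (I → G) → Prop :=
  fun f g h => ∀ i, R (f i) (g i) (h i)

/-- The union of the three binary projections of a ternary relation `R`:
`R₁₂ ∪ R₁₃ ∪ R₂₃`. -/
def LinkRel {G : Type*} (R : G → G → G → Prop) : G → G → Prop :=
  fun a b => (∃ c, R a b c) ∨ (∃ c, R a c b) ∨ (∃ c, R c a b)

/-- Two elements lie in the same connected component: the reflexive–symmetric–transitive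
closure of the union of the binary projections relates them. -/
def SameComp {G : Type*} (R : G → G → G → Prop) : G → G → Prop :=
  Relation.EqvGen (LinkRel R)

/-- Isomorphism of ternary structures: a bijective homomorphism whose inverse is a
homomorphism. -/
def TernaryIso {G H : Type*} (R : G → G → G → Prop) (S : H → H → H → Prop) : Prop :=
  ∃ (F : G → H) (F' : H → G),
    (∀ a b c, R a b c → S (F a) (F b) (F c)) ∧
    (∀ a b c, S a b c → R (F' a) (F' b) (F' c)) ∧
    (∀ a, F' (F a) = a) ∧ (∀ b, F (F' b) = b)

theorem SIRel.isSome_eq {a b c : Option Bool} (h : SIRel a b c) :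
    a.isSome = b.isSome ∧ b.isSome = c.isSome := by
  rcases h with ⟨p, q, r, -, rfl, rfl, rfl⟩ | ⟨rfl, rfl, rfl⟩ <;> simp

theorem SIRel.getD {a b c : Option Bool} (h : SIRel a b c) :
    SRel (a.getD false) (b.getD false) (c.getD false) := by
  rcases h with ⟨p, q, r, h, rfl, rfl, rfl⟩ | ⟨rfl, rfl, rfl⟩
  · exact h
  · simp [SRel]

theorem exists_SIRel {a b : Option Bool} (h : a.isSome = b.isSome) : ∃ c, SIRel a b c := by
  cases a <;> cases b <;> simp_all [SIRel, SRel]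

theorem sameComp_powRel_SIRel_iff {ν : Type u} (z w : ν → Option Bool) :
    SameComp (PowRel ν SIRel) z w ↔ ∀ i, (z i).isSome = (w i).isSome := by
  constructor
  · intro h
    induction h with
    | rel x y h =>
      intro i
      rcases h with ⟨c, h⟩ | ⟨c, h⟩ | ⟨c, h⟩
      · exact (h i).isSome_eq.1
      · exact (h i).isSome_eq.1.trans (h i).isSome_eq.2
      · exact (h i).isSome_eq.2
    | refl x => exact fun _ => rfl
    | symm x y _ ih => exact fun i => (ih i).symm
    | trans x y v _ _ ih₁ ih₂ => exact fun i => (ih₁ i).trans (ih₂ i)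
  · intro h
    choose c hc using fun i => exists_SIRel (h i)
    exact .rel _ _ (.inl ⟨c, hc⟩)

/-- The component of `z` is isomorphic to `𝕊^T` when `T` is the set of coordinates at which `z`
lies in the `𝕊`-part. -/
theorem ternaryIso_component {ν : Type u} (z : ν → Option Bool) (T : Set ν)
    (hT : ∀ i, i ∈ T ↔ (z i).isSome = true) :
    TernaryIso
      (fun x y v : {w : ν → Option Bool // SameComp (PowRel ν SIRel) z w} =>
        PowRel ν SIRel x.1 y.1 v.1)
      (PowRel T SRel) := by
  classical
  refine ⟨fun w i => (w.1 i).getD false,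
    fun f => ⟨fun i => if h : i ∈ T then some (f ⟨i, h⟩) else none, ?_⟩, ?_, ?_, ?_, ?_⟩
  · rw [sameComp_powRel_SIRel_iff]
    intro i
    by_cases h : i ∈ T
    · simp [h, (hT i).1 h]
    · simpa [h] using mt (hT i).2 h
  · exact fun a b c h i => (h i).getD
  · intro a b c h i
    by_cases hi : i ∈ T
    · exact .inl ⟨_, _, _, h ⟨i, hi⟩, by simp [hi], by simp [hi], by simp [hi]⟩
    · exact .inr (by simp [hi])
  · rintro ⟨w, hw⟩
    have hw' := (sameComp_powRel_SIRel_iff z w).1 hw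
    ext1
    funext i
    have h₁ := hT i
    rw [hw' i] at h₁
    cases h : w i <;> simp_all
  · intro f
    funext i
    simp

/-- For the power `(𝕊 ⊔ 𝕀)^ν`, writing `T_z = {i : z i lies in the 𝕊-part}`:
(a) `z` and `w` lie in the same connected component iff `T_z = T_w`;
(b) the connected component of `z` is isomorphic to `𝕊^{T_z}`;
(c) for every `T ⊆ ν` some connected component is isomorphic to `𝕊^T`. -/
theorem stmt10 {ν : Type u} :
    (∀ z w : ν → Option Bool,
      SameComp (PowRel ν SIRel) z w ↔
        {i : ν | (z i).isSome = true} = {i : ν | (w i).isSome = true}) ∧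
    (∀ z : ν → Option Bool,
      TernaryIso
        (fun x y v : {w : ν → Option Bool // SameComp (PowRel ν SIRel) z w} =>
          PowRel ν SIRel x.1 y.1 v.1)
        (PowRel {i : ν | (z i).isSome = true} SRel)) ∧
    (∀ T : Set ν, ∃ z : ν → Option Bool,
      TernaryIso
        (fun x y v : {w : ν → Option Bool // SameComp (PowRel ν SIRel) z w} =>
          PowRel ν SIRel x.1 y.1 v.1)
        (PowRel T SRel)) := by
  classical
  refine ⟨fun z w => ?_, fun z => ternaryIso_component z _ fun _ => Iff.rfl, fun T =>
    ⟨fun i => if i ∈ T then some false else none, ternaryIso_component _ T fun i => ?_⟩⟩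
  · rw [sameComp_powRel_SIRel_iff, Set.ext_iff]
    exact forall_congr' fun i => Bool.eq_iff_iff
  · by_cases h : i ∈ T <;> simp [h]
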